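/- Let E be a smooth homogeneous cubic in S = ℂ[z₀,…,z₄], V = {E = 0} ⊆ ℂ^5, let l_r be a line contained in V and l_s ⊆ ℂ^5 any line. Then every line l_t contained in V with l_t ≠ l_r and l_t ∩ l_r ≠ {0} satisfies l_t ∩ l_s ≠ {0} if and only if l_s = l_r. -/

import Mathlib

open MvPolynomial Module

noncomputable section

/-- `E` is a smooth cubic: it is homogeneous of degree 3 and the only common zero of its
partial derivatives is the origin. -/
def IsSmoothCubic (E : MvPolynomial (Fin 5) ℂ) : Prop :=
  E.IsHomogeneous 3 ∧ ∀ x : Fin 5 → ℂ, (∀ i, eval x (pderiv i E) = 0) → x = 0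

/-- A linear subspace `l ⊆ ℂ⁵` lies in the cubic `V = {E = 0}` if `E` vanishes on it. -/
def SubsetV (E : MvPolynomial (Fin 5) ℂ) (l : Submodule ℂ (Fin 5 → ℂ)) : Prop :=
  ∀ x ∈ l, eval x E = 0


variable {V : Type*} [AddCommGroup V] [Module ℂ V]

/-- Symmetry of a trilinear form. -/
structure IsSymmTrilinear (T : V →ₗ[ℂ] V →ₗ[ℂ] V →ₗ[ℂ] ℂ) : Prop where
  left : ∀ x y z, T x y z = T y x z
  right : ∀ x y z, T x y z = T x z y

/-- The discriminant of the conic residual to the line spanned by `a` and `b` in the plane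
spanned by `a`, `b` and `y`, for the cubic `T x x x = 0`. -/
def residualDisc (T : V →ₗ[ℂ] V →ₗ[ℂ] V →ₗ[ℂ] ℂ) (a b y : V) : ℂ :=
  4 * T y y y * (T a a y * T b b y - T a b y ^ 2)
    - 3 * (T a a y * T b y y ^ 2 - 2 * T a b y * T a y y * T b y y + T b b y * T a y y ^ 2)

theorem exists_isotropic (A B C : ℂ) :
    ∃ s t : ℂ, (s ≠ 0 ∨ t ≠ 0) ∧ s ^ 2 * A + 2 * s * t * B + t ^ 2 * C = 0 := by
  by_cases hA : A = 0
  · exact ⟨1, 0, by simp, by simp [hA]⟩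
  · obtain ⟨d, hd⟩ := IsAlgClosed.exists_pow_nat_eq (B ^ 2 - A * C) (n := 2) (by norm_num)
    refine ⟨-B + d, A, Or.inr hA, ?_⟩
    linear_combination A * hd

theorem exists_orthogonal_basis (A B C : ℂ) (h : ¬ (A = 0 ∧ B = 0 ∧ C = 0)) :
    ∃ p q r s : ℂ, p * s - q * r ≠ 0 ∧ p * r * A + (p * s + q * r) * B + q * s * C = 0 ∧
      r ^ 2 * A + 2 * r * s * B + s ^ 2 * C ≠ 0 := by
  by_cases hC : C = 0
  · by_cases hA : A = 0
    · have hB : B ≠ 0 := fun hB => h ⟨hA, hB, hC⟩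
      refine ⟨1, -1, 1, 1, by norm_num, by simp [hA, hC], by simpa [hA, hC] using hB⟩
    · refine ⟨-(B / A), 1, 1, 0, by norm_num, ?_, by simpa using hA⟩
      field_simp; ring
  · refine ⟨1, -(B / C), 0, 1, by norm_num, ?_, by simpa using hC⟩
    field_simp; ring

theorem coeff_eq_zero_of_roots_eq_zero {c₀ c₁ c₂ c₃ c₄ c₅ : ℂ} (h₅ : c₅ ≠ 0)
    (h : ∀ t, t ≠ 0 →
      c₀ + c₁ * t + c₂ * t ^ 2 + c₃ * t ^ 3 + c₄ * t ^ 4 + c₅ * t ^ 5 ≠ 0) :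
    c₀ = 0 ∧ c₁ = 0 ∧ c₂ = 0 := by
  let p : Polynomial ℂ :=
    Polynomial.C c₀ + Polynomial.C c₁ * Polynomial.X + Polynomial.C c₂ * Polynomial.X ^ 2
    + Polynomial.C c₃ * Polynomial.X ^ 3 + Polynomial.C c₄ * Polynomial.X ^ 4
    + Polynomial.C c₅ * Polynomial.X ^ 5
  have hroots : ∀ r ∈ p.roots, r = 0 := by
    intro r hr
    by_contra hr0
    have := (Polynomial.mem_roots'.1 hr).2
    exact h r hr0 (by simpa [p] using this)
  have hdeg : p.natDegree = 5 := by
    simp only [p]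
    compute_degree!
  have hcard : p.roots.card = 5 := by
    rw [← hdeg]; exact (IsAlgClosed.splits p).natDegree_eq_card_roots.symm
  have hr : p.roots = Multiset.replicate 5 0 := Multiset.eq_replicate.2 ⟨hcard, hroots⟩
  have hp := (IsAlgClosed.splits p).eq_prod_roots
  rw [hr] at hp
  simp only [Multiset.map_replicate, Multiset.prod_replicate, Polynomial.C_0, sub_zero] at hp
  have hc : ∀ i < 5, p.coeff i = 0 := by
    intro i hi
    rw [hp, Polynomial.coeff_C_mul, Polynomial.coeff_X_pow]
    simp [hi.ne]
  have h0 := hc 0 (by norm_num)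
  have h1 := hc 1 (by norm_num)
  have h2 := hc 2 (by norm_num)
  simp [p, Polynomial.coeff_X, Polynomial.coeff_C] at h0 h1 h2
  exact ⟨h0, h1, h2⟩

theorem eq_zero_of_generic_eq_zero {m₀ m₁ n₀ n₁ g₀ g₁ g₂ : ℂ} (hm : m₁ ≠ 0) (hn : n₁ ≠ 0)
    (h : ∀ s, m₀ + m₁ * s ≠ 0 → n₀ + n₁ * s ≠ 0 → g₀ + g₁ * s + g₂ * s ^ 2 = 0) :
    g₀ = 0 := by
  let g : Polynomial ℂ :=
    Polynomial.C g₀ + Polynomial.C g₁ * Polynomial.X + Polynomial.C g₂ * Polynomial.X ^ 2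
  let m : Polynomial ℂ := Polynomial.C m₀ + Polynomial.C m₁ * Polynomial.X
  let n : Polynomial ℂ := Polynomial.C n₀ + Polynomial.C n₁ * Polynomial.X
  have hm0 : m ≠ 0 := fun h0 => hm (by
    simpa [m, Polynomial.coeff_C] using congrArg (fun p => Polynomial.coeff p 1) h0)
  have hn0 : n ≠ 0 := fun h0 => hn (by
    simpa [n, Polynomial.coeff_C] using congrArg (fun p => Polynomial.coeff p 1) h0)
  have hprod : m * n * g = 0 := by
    refine Polynomial.funext fun s => ?_
    simp only [Polynomial.eval_mul, Polynomial.eval_zero, mul_eq_zero]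
    by_contra! hne
    refine hne.2 ?_
    have := h s (by simpa [m] using hne.1.1) (by simpa [n] using hne.1.2)
    simpa [g] using this
  have hg : g = 0 := (mul_eq_zero.1 hprod).resolve_left (mul_ne_zero hm0 hn0)
  simpa [g] using congrArg (fun p => Polynomial.coeff p 0) hg

theorem exists_ne_zero_ne_zero {m n : V →ₗ[ℂ] ℂ} (hm : m ≠ 0) (hn : n ≠ 0) :
    ∃ w, m w ≠ 0 ∧ n w ≠ 0 := by
  obtain ⟨x, hx⟩ := DFunLike.ne_iff.1 hm
  obtain ⟨y, hy⟩ := DFunLike.ne_iff.1 hn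
  simp only [LinearMap.zero_apply] at hx hy
  by_cases hx' : n x = 0
  · by_cases hy' : m y = 0
    · exact ⟨x + y, by simpa [hy'] using hx, by simpa [hx'] using hy⟩
    · exact ⟨y, hy', hy⟩
  · exact ⟨x, hx, hx'⟩

theorem exists_pencil_eq_zero {α β γ : V →ₗ[ℂ] ℂ} (h : ∀ w, α w * γ w = β w ^ 2) :
    ∃ s t : ℂ, (s ≠ 0 ∨ t ≠ 0) ∧ ∀ w, s ^ 2 * α w + 2 * s * t * β w + t ^ 2 * γ w = 0 := by
  by_cases hα : α = 0
  · exact ⟨1, 0, by simp, fun w => by simp [hα]⟩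
  obtain ⟨x, hx⟩ := DFunLike.ne_iff.1 hα
  simp only [LinearMap.zero_apply] at hx
  have hβ : ∀ w, α x * β w = β x * α w := by
    intro w
    have := h (α x • w - α w • x)
    simp only [map_sub, map_smul, smul_eq_mul] at this
    have h2 : (α x * β w - α w * β x) ^ 2 = 0 := by rw [← this]; ring
    have := pow_eq_zero_iff (two_ne_zero) |>.1 h2
    linear_combination this
  have hγ : ∀ w, α x * γ w = γ x * α w := by
    intro w
    have h1 := h w
    have h2 := h x
    have h3 := h (x + w)
    simp only [map_add] at h3
    have h4 := hβ w
    refine mul_left_cancel₀ hx ?_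
    linear_combination α x * h3 - α x * h2 - α x * h1 + 2 * β x * h4 - 2 * α w * h2
  refine ⟨-β x, α x, Or.inr hx, fun w => ?_⟩
  linear_combination (-2 * β x) * hβ w + (α x) * hγ w + α w * h x

theorem span_pair_eq {l : Submodule ℂ V} (hl : finrank ℂ l = 2) {a b : V} (ha : a ∈ l)
    (hb : b ∈ l) (hab : LinearIndependent ℂ ![a, b]) : Submodule.span ℂ {a, b} = l := by
  have : FiniteDimensional ℂ l := FiniteDimensional.of_finrank_pos (by omega)
  refine Submodule.eq_of_le_of_finrank_eq ?_ ?_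
  · rw [Submodule.span_le]
    rintro x (rfl | rfl) <;> assumption
  · have := finrank_span_eq_card hab
    rw [Matrix.range_cons, Matrix.range_cons, Matrix.range_empty, Set.union_empty] at this
    rw [hl, Set.insert_eq, this, Fintype.card_fin]

theorem LinearIndependent.pair_of_det_ne_zero {a b : V} (hab : LinearIndependent ℂ ![a, b])
    {p q r s : ℂ} (h : p * s - q * r ≠ 0) :
    LinearIndependent ℂ ![p • a + q • b, r • a + s • b] := by
  rw [LinearIndependent.pair_iff] at hab ⊢
  intro x y hxy
  obtain ⟨h1, h2⟩ := hab (x * p + y * r) (x * q + y * s) (by rw [← hxy]; module)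
  constructor <;> refine mul_left_cancel₀ h ?_
  · linear_combination s * h1 - r * h2
  · linear_combination -q * h1 + p * h2


theorem pderiv_pderiv_comm {σ : Type*} (i j : σ) (f : MvPolynomial σ ℂ) :
    pderiv i (pderiv j f) = pderiv j (pderiv i f) := by
  classical
  have h : ⁅pderiv (R := ℂ) i, pderiv (R := ℂ) j⁆ = 0 := by
    refine MvPolynomial.derivation_ext fun k => ?_
    rw [Derivation.commutator_apply]
    simp [pderiv_X, Pi.single_apply, apply_ite]
  have := congrArg (fun D => D f) h
  simpa [Derivation.commutator_apply, sub_eq_zero] using this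

theorem exists_symmTrilinear {E : MvPolynomial (Fin 5) ℂ} (hE : IsSmoothCubic E) :
    ∃ T : (Fin 5 → ℂ) →ₗ[ℂ] (Fin 5 → ℂ) →ₗ[ℂ] (Fin 5 → ℂ) →ₗ[ℂ] ℂ,
      IsSymmTrilinear T ∧ (∀ x, eval x E = T x x x) ∧ ∀ x, x ≠ 0 → ∃ w, T x x w ≠ 0 := by
  obtain ⟨hom, hs⟩ := hE
  let c : Fin 5 → Fin 5 → Fin 5 → ℂ := fun i j k =>
    eval 0 (pderiv k (pderiv j (pderiv i E))) / 6
  let T : (Fin 5 → ℂ) →ₗ[ℂ] (Fin 5 → ℂ) →ₗ[ℂ] (Fin 5 → ℂ) →ₗ[ℂ] ℂ :=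
    ∑ i, ∑ j, ∑ k, c i j k • (LinearMap.proj i).smulRight
      ((LinearMap.proj j).smulRight (LinearMap.proj k))
  have hT : ∀ x y z, T x y z = ∑ i, ∑ j, ∑ k, c i j k * (x i * (y j * z k)) := by
    intro x y z
    simp [T]
  have euler : ∀ {n : ℕ} {f : MvPolynomial (Fin 5) ℂ} (x : Fin 5 → ℂ), f.IsHomogeneous n →
      ∑ i, x i * eval x (pderiv i f) = n * eval x f := by
    intro n f x hf
    simpa using congrArg (eval x) hf.sum_X_mul_pderiv
  have const : ∀ {f : MvPolynomial (Fin 5) ℂ} (x : Fin 5 → ℂ), f.IsHomogeneous 0 →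
      eval x f = eval 0 f := by
    intro f x hf
    rw [← totalDegree_zero_iff_isHomogeneous, totalDegree_eq_zero_iff_eq_C] at hf
    rw [hf]; simp
  have grad : ∀ x i, eval x (pderiv i E) = 3 * ∑ j, ∑ k, c i j k * (x j * x k) := by
    intro x i
    have h1 := euler x (hom.pderiv (i := i))
    have h2 : ∀ j, ∑ k, x k * (c i j k * 6) = eval x (pderiv j (pderiv i E)) := by
      intro j
      have h2 := euler x ((hom.pderiv (i := i)).pderiv (i := j))
      simp only [Nat.reduceSub, Nat.cast_one, one_mul] at h2
      rw [← h2]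
      refine Finset.sum_congr rfl fun k _ => ?_
      rw [const x (((hom.pderiv (i := i)).pderiv (i := j)).pderiv (i := k))]
      simp only [c]; ring
    simp only [← h2, Nat.reduceSub, Nat.cast_ofNat] at h1
    have h3 : eval x (pderiv i E) = (∑ j, x j * ∑ k, x k * (c i j k * 6)) / 2 := by
      rw [h1]; ring
    rw [h3, Finset.sum_div, Finset.mul_sum]
    refine Finset.sum_congr rfl fun j _ => ?_
    rw [Finset.mul_sum, Finset.sum_div, Finset.mul_sum]
    exact Finset.sum_congr rfl fun k _ => by ring
  have hsymm : IsSymmTrilinear T := by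
    refine ⟨fun x y z => ?_, fun x y z => ?_⟩
    · rw [hT, hT, Finset.sum_comm]
      refine Finset.sum_congr rfl fun i _ => Finset.sum_congr rfl fun j _ =>
        Finset.sum_congr rfl fun k _ => ?_
      simp only [c, pderiv_pderiv_comm i j]; ring
    · rw [hT, hT]
      refine Finset.sum_congr rfl fun i _ => ?_
      rw [Finset.sum_comm]
      refine Finset.sum_congr rfl fun j _ => Finset.sum_congr rfl fun k _ => ?_
      simp only [c, pderiv_pderiv_comm j k]; ring
  refine ⟨T, hsymm, fun x => ?_, fun x hx => ?_⟩
  · have h1 := euler x hom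
    simp only [grad, Nat.cast_ofNat] at h1
    have h2 : eval x E = ∑ i, x i * ∑ j, ∑ k, c i j k * (x j * x k) := by
      refine mul_left_cancel₀ (three_ne_zero (α := ℂ)) ?_
      rw [← h1, Finset.mul_sum]
      exact Finset.sum_congr rfl fun i _ => by ring
    rw [h2, hT]
    simp only [Finset.mul_sum]
    refine Finset.sum_congr rfl fun i _ => Finset.sum_congr rfl fun j _ =>
        Finset.sum_congr rfl fun k _ => by ring
  · by_contra! h
    refine hx (hs x fun i => ?_)
    have h1 := h (Pi.single i 1)
    rw [hsymm.right, hsymm.left, hT] at h1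
    rw [grad]
    simp only [Pi.single_apply, ite_mul, one_mul, zero_mul, mul_ite, mul_zero,
      Finset.sum_ite_irrel, Finset.sum_const_zero, Finset.sum_ite_eq', Finset.mem_univ, if_true]
      at h1
    rw [h1, mul_zero]

variable {T : V →ₗ[ℂ] V →ₗ[ℂ] V →ₗ[ℂ] ℂ}

theorem IsSymmTrilinear.apply_self_left_eq_zero (hT : IsSymmTrilinear T) {l : Submodule ℂ V}
    (hl : ∀ x ∈ l, T x x x = 0) {x y : V} (hx : x ∈ l) (hy : y ∈ l) : T x x y = 0 := by
  have h1 := hl _ (add_mem hx hy)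
  have h2 := hl _ (sub_mem hx hy)
  have h3 := hl _ hx
  have h4 := hl _ hy
  simp only [map_add, map_sub, LinearMap.add_apply, LinearMap.sub_apply, hT.left y x x,
    hT.right x y x, hT.left y x y, hT.right y y x] at h1 h2
  linear_combination (1 / 6) * h1 - (1 / 6) * h2 - (1 / 3) * h4

theorem IsSymmTrilinear.apply_comb (hT : IsSymmTrilinear T) (a b y : V) (p q r s : ℂ) :
    T (p • a + q • b) (r • a + s • b) y =
      p * r * T a a y + (p * s + q * r) * T a b y + q * s * T b b y := by
  simp only [map_add, map_smul, LinearMap.add_apply, LinearMap.smul_apply, smul_eq_mul,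
    hT.left b a]
  ring

theorem IsSymmTrilinear.apply_comb_self (hT : IsSymmTrilinear T) (a b y : V) (p q : ℂ) :
    T (p • a + q • b) (p • a + q • b) y =
      p ^ 2 * T a a y + 2 * p * q * T a b y + q ^ 2 * T b b y := by
  rw [hT.apply_comb]; ring

section Line

variable {l : Submodule ℂ V}

theorem IsSymmTrilinear.residualDisc_comb (hT : IsSymmTrilinear T) (a b y : V)
    (p q r s : ℂ) : residualDisc T (p • a + q • b) (r • a + s • b) y =
      (p * s - q * r) ^ 2 * residualDisc T a b y := by
  simp only [residualDisc, map_add, map_smul, LinearMap.add_apply, LinearMap.smul_apply,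
    smul_eq_mul, hT.left b a]
  ring

/-- How the coefficients of the residual conic change when `y` is translated along the line. -/
theorem IsSymmTrilinear.apply_translate (hT : IsSymmTrilinear T)
    (hl : ∀ x ∈ l, T x x x = 0) {a b : V} (ha : a ∈ l) (hb : b ∈ l) {y y' : V} {s t : ℂ}
    (hy' : y' = y + (s • a + t • b)) :
    T a a y' = T a a y ∧ T a b y' = T a b y ∧ T b b y' = T b b y ∧
      T a y' y' = T a y y + 2 * s * T a a y + 2 * t * T a b y ∧
      T b y' y' = T b y y + 2 * s * T a b y + 2 * t * T b b y ∧
      T y' y' y' = T y y y + 3 * s * T a y y + 3 * t * T b y y + 3 * s ^ 2 * T a a y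
        + 6 * s * t * T a b y + 3 * t ^ 2 * T b b y := by
  have h1 := hl a ha
  have h2 := hl b hb
  have h3 := hT.apply_self_left_eq_zero hl ha hb
  have h4 := hT.apply_self_left_eq_zero hl hb ha
  have e1 : T a b a = 0 := by rw [hT.right, h3]
  have e2 : T a b b = 0 := by rw [hT.left, hT.right, h4]
  have e3 : T y a a = T a a y := by rw [hT.left, hT.right]
  have e4 : T y a b = T a b y := by rw [hT.left, hT.right]
  have e5 : T y b a = T a b y := by rw [hT.right, e4]
  have e6 : T y b b = T b b y := by rw [hT.left, hT.right]
  have e7 : T y y a = T a y y := by rw [hT.right, hT.left]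
  have e8 : T y y b = T b y y := by rw [hT.right, hT.left]
  subst hy'
  refine ⟨?_, ?_, ?_, ?_, ?_, ?_⟩ <;>
  · simp only [map_add, map_smul, LinearMap.add_apply, LinearMap.smul_apply, smul_eq_mul,
      hT.left b a, hT.left y a y, hT.left y b y, hT.right a y a, hT.right a y b,
      hT.right b y a, hT.right b y b, e1, e2, e3, e4, e5, e6, e7, e8, h1, h2, h3, h4]
    ring

theorem IsSymmTrilinear.residualDisc_translate (hT : IsSymmTrilinear T)
    (hl : ∀ x ∈ l, T x x x = 0) {a b : V} (ha : a ∈ l) (hb : b ∈ l) {y y' : V} {s t : ℂ}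
    (hy' : y' = y + (s • a + t • b)) : residualDisc T a b y' = residualDisc T a b y := by
  obtain ⟨h1, h2, h3, h4, h5, h6⟩ := hT.apply_translate hl ha hb hy'
  simp only [residualDisc, h1, h2, h3, h4, h5, h6]
  ring

/-- After changing the basis of the line and translating `y` along it, the matrix of the
residual conic is diagonal, or almost so. -/
theorem IsSymmTrilinear.exists_normal_form (hT : IsSymmTrilinear T)
    (hl : ∀ x ∈ l, T x x x = 0) {a b y : V} (ha : a ∈ l) (hb : b ∈ l)
    (hab : LinearIndependent ℂ ![a, b]) (hy : ∃ u ∈ l, ∃ v ∈ l, T u v y ≠ 0)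
    (hspan : Submodule.span ℂ {a, b} = l) :
    ∃ a' ∈ l, ∃ b' ∈ l, ∃ y', y' - y ∈ l ∧ LinearIndependent ℂ ![a', b'] ∧
      T a' b' y' = 0 ∧ T b' b' y' ≠ 0 ∧ T b' y' y' = 0 ∧
      (T a' a' y' ≠ 0 → T a' y' y' = 0) ∧
      (residualDisc T a b y = 0 → residualDisc T a' b' y' = 0) := by
  have hABC : ¬ (T a a y = 0 ∧ T a b y = 0 ∧ T b b y = 0) := by
    rintro ⟨h1, h2, h3⟩
    obtain ⟨u, hu, v, hv, huv⟩ := hy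
    rw [← hspan, Submodule.mem_span_pair] at hu hv
    obtain ⟨p, q, rfl⟩ := hu
    obtain ⟨r, s, rfl⟩ := hv
    exact huv (by rw [hT.apply_comb, h1, h2, h3]; ring)
  obtain ⟨p, q, r, s, hdet, hB, hC⟩ := exists_orthogonal_basis _ _ _ hABC
  have hLI := hab.pair_of_det_ne_zero hdet
  have hdisc := hT.residualDisc_comb a b y p q r s
  have ha' : p • a + q • b ∈ l := add_mem (l.smul_mem _ ha) (l.smul_mem _ hb)
  have hb' : r • a + s • b ∈ l := add_mem (l.smul_mem _ ha) (l.smul_mem _ hb)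
  rw [← hT.apply_comb] at hB
  rw [← hT.apply_comb_self] at hC
  generalize p • a + q • b = a' at *
  generalize r • a + s • b = b' at *
  obtain ⟨σ, hσ⟩ : ∃ σ : ℂ, T a' a' y ≠ 0 → T a' y y + 2 * σ * T a' a' y = 0 := by
    by_cases hA : T a' a' y = 0
    · exact ⟨0, fun h => absurd hA h⟩
    · exact ⟨-(T a' y y / (2 * T a' a' y)), fun _ => by field_simp; ring⟩
  obtain ⟨y', hy'⟩ : ∃ y', y' = y + (σ • a' + (-(T b' y y / (2 * T b' b' y))) • b') := ⟨_, rfl⟩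
  obtain ⟨e1, e2, e3, e4, e5, -⟩ := hT.apply_translate hl ha' hb' hy'
  refine ⟨a', ha', b', hb', y', ?_, hLI, ?_, ?_, ?_, ?_, ?_⟩
  · rw [hy', add_sub_cancel_left]
    exact add_mem (l.smul_mem _ ha') (l.smul_mem _ hb')
  · rw [e2, hB]
  · rwa [e3]
  · rw [e5, hB]; field_simp; ring
  · rw [e1, e4, hB, mul_zero, add_zero]; exact hσ
  · intro h0
    rw [hT.residualDisc_translate hl ha' hb' hy', hdisc, h0, mul_zero]

/-- If the residual conic is singular, the plane spanned by the line and `y` contains a second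
line, spanned by `u` and `v`, of the cubic. -/
theorem IsSymmTrilinear.exists_residual_line (hT : IsSymmTrilinear T)
    (hl : ∀ x ∈ l, T x x x = 0) {a b y : V} (ha : a ∈ l) (hb : b ∈ l)
    (hab : LinearIndependent ℂ ![a, b]) (hy : ∃ u ∈ l, ∃ v ∈ l, T u v y ≠ 0)
    (hspan : Submodule.span ℂ {a, b} = l) (hdisc : residualDisc T a b y = 0) :
    ∃ u ∈ l, u ≠ 0 ∧ ∃ v, v - y ∈ l ∧ T u u v = 0 ∧ T u v v = 0 ∧ T v v v = 0 := by
  obtain ⟨a, ha, b, hb, y', hyy', hab', hB, hC, hR, hP, h0⟩ :=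
    hT.exists_normal_form hl ha hb hab hy hspan
  have h0 := h0 hdisc
  rw [LinearIndependent.pair_iff] at hab'
  simp only [residualDisc, hB, hR] at h0
  by_cases hA : T a a y' = 0
  · have hP' : T a y' y' = 0 := by simpa [hA, hC] using h0
    obtain ⟨s, hs⟩ := IsAlgClosed.exists_pow_nat_eq (-(T y' y' y') / (3 * T b b y')) (n := 2)
      (by norm_num)
    refine ⟨a, ha, fun h => ?_, y' + s • b, ?_, ?_, ?_, ?_⟩
    · simpa using hab' 1 0 (by simp [h])
    · rw [add_sub_right_comm]; exact add_mem hyy' (l.smul_mem _ hb)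
    · simp [hA, hT.apply_self_left_eq_zero hl ha hb]
    · have := hT.apply_self_left_eq_zero hl hb ha
      rw [hT.right, hT.left] at this
      simp [hP', hB, hT.right a y' b, this]
    · have := hl b hb
      simp only [map_add, map_smul, LinearMap.add_apply, LinearMap.smul_apply, smul_eq_mul,
        hT.left y' b, hT.right y' y' b, hT.right b y' b, hR, this]
      field_simp at hs
      linear_combination hs
  · have hP' := hP hA
    have hD : T y' y' y' = 0 := by simpa [hA, hC, hP'] using h0
    obtain ⟨s, t, hst, h⟩ := exists_isotropic (T a a y') (T a b y') (T b b y')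
    refine ⟨s • a + t • b, add_mem (l.smul_mem _ ha) (l.smul_mem _ hb), fun h' => ?_, y', hyy',
      ?_, ?_, hD⟩
    · have := hab' s t h'
      tauto
    · rw [hT.apply_comb_self, h]
    · simp [hP', hR]

theorem exists_mem_ker_apply_ne_zero (hT : IsSymmTrilinear T)
    (hs : ∀ x, x ≠ 0 → ∃ w, T x x w ≠ 0) {a b : V} (ha : a ∈ l) (hb : b ∈ l)
    (hab : LinearIndependent ℂ ![a, b]) {m : V →ₗ[ℂ] ℂ} (hm : m ≠ 0) :
    ∃ y, m y = 0 ∧ ∃ u ∈ l, ∃ v ∈ l, T u v y ≠ 0 := by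
  by_contra! h
  obtain ⟨w, hw⟩ := DFunLike.ne_iff.1 hm
  rw [LinearMap.zero_apply] at hw
  obtain ⟨s, t, hst, h0⟩ := exists_isotropic (T a a w) (T a b w) (T b b w)
  rw [← hT.apply_comb_self] at h0
  have hx : s • a + t • b ∈ l := add_mem (l.smul_mem _ ha) (l.smul_mem _ hb)
  have hne : s • a + t • b ≠ 0 := fun h' => by
    have := LinearIndependent.pair_iff.1 hab s t h'
    tauto
  obtain ⟨z, hz⟩ := hs _ hne
  have := h (m w • z - m z • w) (by simp [mul_comm]) _ hx _ hx
  rw [map_sub, map_smul, map_smul, h0, smul_zero, sub_zero, smul_eq_mul] at this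
  exact (mul_ne_zero hw hz) this

theorem IsSymmTrilinear.residualDisc_add_smul (hT : IsSymmTrilinear T) {a b y : V}
    (hB : T a b y = 0) (hR : T b y y = 0) (w : V) : ∃ c₃ c₄ : ℂ, ∀ t : ℂ,
    residualDisc T a b (y + t • w) =
      (4 * T y y y * T a a y * T b b y - 3 * T b b y * T a y y ^ 2) +
      (12 * T y y w * T a a y * T b b y
        + 4 * T y y y * (T a a w * T b b y + T a a y * T b b w)
        - 3 * T b b w * T a y y ^ 2 - 12 * T b b y * T a y y * T a y w) * t +
      (12 * T y w w * T a a y * T b b y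
        + 12 * T y y w * (T a a w * T b b y + T a a y * T b b w)
        + 4 * T y y y * (T a a w * T b b w - T a b w ^ 2)
        - 3 * (4 * T a a y * T b y w ^ 2 - 4 * T a b w * T a y y * T b y w
          + T b b y * (4 * T a y w ^ 2 + 2 * T a y y * T a w w)
          + 4 * T b b w * T a y y * T a y w)) * t ^ 2 +
      c₃ * t ^ 3 + c₄ * t ^ 4 + residualDisc T a b w * t ^ 5 := by
  refine ⟨4 * (T w w w * T a a y * T b b y
        + 3 * T y w w * (T a a w * T b b y + T a a y * T b b w)
        + 3 * T y y w * (T a a w * T b b w - T a b w ^ 2))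
      - 3 * (4 * T a a y * T b y w * T b w w + 4 * T a a w * T b y w ^ 2
        - 2 * T a b w * (T b w w * T a y y + 4 * T a y w * T b y w)
        + 4 * T b b y * T a y w * T a w w
        + T b b w * (4 * T a y w ^ 2 + 2 * T a y y * T a w w)),
    4 * (T w w w * (T a a w * T b b y + T a a y * T b b w)
        + 3 * T y w w * (T a a w * T b b w - T a b w ^ 2))
      - 3 * (T a a y * T b w w ^ 2 + 4 * T a a w * T b y w * T b w w
        - 4 * T a b w * (T a y w * T b w w + T a w w * T b y w)
        + T b b y * T a w w ^ 2 + 4 * T b b w * T a y w * T a w w), fun t => ?_⟩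
  simp only [residualDisc, map_add, map_smul, LinearMap.add_apply, LinearMap.smul_apply,
    smul_eq_mul, hB, hR, hT.left w y, hT.right w w y, hT.right a w y, hT.right b w y,
    hT.right y w y]
  ring

/-- The discriminant of the projection of a smooth cubic from a line contained in it is not
supported on two hyperplanes, even if the second one may be chosen through a given point of the
first. -/
theorem IsSymmTrilinear.not_residualDisc_subset_lines (hT : IsSymmTrilinear T)
    (hs : ∀ x, x ≠ 0 → ∃ w, T x x w ≠ 0) (hl : ∀ x ∈ l, T x x x = 0) {a b : V} (ha : a ∈ l)
    (hb : b ∈ l) (hab : LinearIndependent ℂ ![a, b]) (hspan : Submodule.span ℂ {a, b} = l)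
    {m : V →ₗ[ℂ] ℂ} (hm : m ≠ 0) (hml : ∀ x ∈ l, m x = 0) :
    ¬ ∀ y₀, (∃ u ∈ l, ∃ v ∈ l, T u v y₀ ≠ 0) → ∃ n : V →ₗ[ℂ] ℂ, n ≠ 0 ∧ n y₀ = 0 ∧
      ∀ a ∈ l, ∀ b ∈ l, LinearIndependent ℂ ![a, b] → ∀ y, residualDisc T a b y = 0 →
        m y = 0 ∨ n y = 0 := by
  intro H
  obtain ⟨y₁, hmy₁, hy₁⟩ := exists_mem_ker_apply_ne_zero hT hs ha hb hab hm
  obtain ⟨a, ha, b, hb, y, hyy, hab, hB, hC, hR, hP, -⟩ :=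
    hT.exists_normal_form hl ha hb hab hy₁ hspan
  have hmy : m y = 0 := by
    have := hml _ hyy
    rwa [map_sub, hmy₁, sub_zero] at this
  have hyl : y ∉ l := fun h => hC (hT.apply_self_left_eq_zero hl hb h)
  obtain ⟨n, hn, hny, hmn⟩ := H y ⟨b, hb, b, hb, hC⟩
  have hmn := hmn a ha b hb hab
  choose c₃ c₄ hc using fun w => hT.residualDisc_add_smul hB hR w
  have key := fun w (hmw : m w ≠ 0) (hnw : n w ≠ 0) =>
    coeff_eq_zero_of_roots_eq_zero (fun h => (hmn w h).elim hmw hnw) fun t ht h =>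
      absurd (hmn _ ((hc w t).trans h)) (by simp [hmy, hny, ht, hmw, hnw])
  obtain ⟨w₁, hmw₁, hnw₁⟩ := exists_ne_zero_ne_zero hm hn
  have generic : ∀ α β γ : V →ₗ[ℂ] ℂ,
      (∀ w, m w ≠ 0 → n w ≠ 0 → α w * γ w = β w ^ 2) → ∀ w, α w * γ w = β w ^ 2 := by
    intro α β γ h w
    rw [← sub_eq_zero]
    refine eq_zero_of_generic_eq_zero hmw₁ hnw₁ (m₀ := m w) (n₀ := n w)
      (g₁ := α w * γ w₁ + α w₁ * γ w - 2 * β w * β w₁) (g₂ := α w₁ * γ w₁ - β w₁ ^ 2)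
      fun s h1 h2 => ?_
    have := h (w + s • w₁) (by simpa [mul_comm] using h1) (by simpa [mul_comm] using h2)
    simp only [map_add, map_smul, smul_eq_mul] at this
    linear_combination this
  have generic' : ∀ x, (∀ w, m w ≠ 0 → n w ≠ 0 → T x x w = 0) → x = 0 := by
    intro x hx
    by_contra hx0
    obtain ⟨w, hw⟩ := hs x hx0
    have := generic (T x x) 0 (T x x) (fun w h1 h2 => by simp [hx w h1 h2]) w
    simp [hw] at this
  have hy0 : y ≠ 0 := fun h => hyl (h ▸ l.zero_mem)
  have ha0 : a ≠ 0 := fun h => by simpa using LinearIndependent.pair_iff.1 hab 1 0 (by simp [h])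
  by_cases hA : T a a y = 0
  · have hP0 : T a y y = 0 := by
      simpa [hA, hC] using (key w₁ hmw₁ hnw₁).1
    by_cases hD : T y y y = 0
    · have h2 := generic (T a a) (T a y) (T y y) fun w h1 h2 => by
        have h3 := (key w h1 h2).2.2
        simp only [hA, hP0, hD] at h3
        refine mul_left_cancel₀ (mul_ne_zero (by norm_num : (12 : ℂ) ≠ 0) hC) ?_
        linear_combination h3
      obtain ⟨s, t, hst, h⟩ := exists_pencil_eq_zero h2
      have hx : s • a + t • y = 0 := by
        by_contra hx
        obtain ⟨w, hw⟩ := hs _ hx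
        exact hw (by rw [hT.apply_comb_self, h])
      have ht : t = 0 := by
        by_contra ht
        refine hyl ?_
        rw [(eq_inv_smul_iff₀ ht).2 (eq_neg_of_add_eq_zero_right hx)]
        exact l.smul_mem _ (neg_mem (l.smul_mem _ ha))
      simp [ht, ha0] at hx hst
      exact hst hx
    · refine ha0 (generic' a fun w h1 h2 => ?_)
      simpa [hA, hP0, hD, hC] using (key w h1 h2).2.1
  · have hP0 := hP hA
    have hD : T y y y = 0 := by
      simpa [hP0, hA, hC] using (key w₁ hmw₁ hnw₁).1
    refine hy0 (generic' y fun w h1 h2 => ?_)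
    simpa [hA, hP0, hD, hC] using (key w h1 h2).2.1

end Line

theorem exists_ne_zero_le_ker [FiniteDimensional ℂ V] {W : Submodule ℂ V}
    (hW : finrank ℂ W < finrank ℂ V) : ∃ m : V →ₗ[ℂ] ℂ, m ≠ 0 ∧ ∀ x ∈ W, m x = 0 := by
  have hlt : W < ⊤ := lt_top_iff_ne_top.2 fun h => by
    rw [h, finrank_top] at hW
    exact lt_irrefl _ hW
  obtain ⟨m, hm, hmW⟩ := Submodule.exists_le_ker_of_lt_top W hlt
  exact ⟨m, hm, fun x hx => LinearMap.mem_ker.1 (hmW hx)⟩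

/-- Let `V` be 5-dimensional, so that `T x x x = 0` is a smooth cubic threefold. A line `ls` which
meets all lines of the cubic that meet the line `lr` of the cubic coincides with `lr`. -/
theorem IsSymmTrilinear.eq_of_forall_meet [FiniteDimensional ℂ V] (hV : finrank ℂ V = 5)
    (hT : IsSymmTrilinear T) (hs : ∀ x, x ≠ 0 → ∃ w, T x x w ≠ 0) {lr ls : Submodule ℂ V}
    (hlr : finrank ℂ lr = 2) (hls : finrank ℂ ls = 2) (hl : ∀ x ∈ lr, T x x x = 0)
    (hmeet : ∀ u ∈ lr, u ≠ 0 → ∀ v, v ∉ lr → T u u v = 0 → T u v v = 0 → T v v v = 0 →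
      ∃ α β : ℂ, α • u + β • v ∈ ls ∧ α • u + β • v ≠ 0) : ls = lr := by
  by_contra hne
  obtain ⟨a, ha, b, hb, hab⟩ : ∃ a ∈ lr, ∃ b ∈ lr, LinearIndependent ℂ ![a, b] := by
    let B := finBasisOfFinrankEq ℂ lr hlr
    refine ⟨B 0, (B 0).2, B 1, (B 1).2, ?_⟩
    have h : ![(B 0 : V), (B 1 : V)] = lr.subtype ∘ B := by
      funext i
      fin_cases i <;> rfl
    rw [h]
    exact B.linearIndependent.map' lr.subtype lr.ker_subtype
  have hspan := span_pair_eq hlr ha hb hab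
  have meet : ∀ a ∈ lr, ∀ b ∈ lr, LinearIndependent ℂ ![a, b] → ∀ y,
      (∃ u ∈ lr, T u u y ≠ 0) → residualDisc T a b y = 0 →
      y ∈ lr ⊔ ls ∨ ∃ u ∈ lr, u ∈ ls ∧ u ≠ 0 ∧ T u u y = 0 := by
    rintro a ha b hb hab y ⟨u₀, hu₀, hy⟩ hdisc
    obtain ⟨u, hu, hu0, v, hvy, h1, h2, h3⟩ := hT.exists_residual_line hl ha hb hab
      ⟨u₀, hu₀, u₀, hu₀, hy⟩ (span_pair_eq hlr ha hb hab) hdisc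
    have hvl : v ∉ lr := fun hv => hy (hT.apply_self_left_eq_zero hl hu₀
      ((Submodule.sub_mem_iff_right _ hv).1 hvy))
    obtain ⟨α, β, hmem, hne⟩ := hmeet u hu hu0 v hvl h1 h2 h3
    by_cases hβ : β = 0
    · rw [hβ, zero_smul, add_zero] at hmem hne
      refine Or.inr ⟨u, hu, ?_, hu0, ?_⟩
      · refine (Submodule.smul_mem_iff _ ?_).1 hmem
        rintro rfl
        exact hne (zero_smul _ _)
      · have := hT.apply_self_left_eq_zero hl hu hvy
        rwa [map_sub, h1, zero_sub, neg_eq_zero] at this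
    · left
      have h4 : β • v ∈ lr ⊔ ls := by
        have := sub_mem (Submodule.mem_sup_right (S := lr) hmem)
          (Submodule.mem_sup_left (T := ls) (lr.smul_mem α hu))
        rwa [add_sub_cancel_left] at this
      have h5 := (Submodule.smul_mem_iff _ hβ).1 h4
      have := sub_mem h5 (Submodule.mem_sup_left (T := ls) hvy)
      rwa [sub_sub_cancel] at this
  have hdim := Submodule.finrank_sup_add_finrank_inf_eq lr ls
  by_cases hinf : lr ⊓ ls = ⊥
  · obtain ⟨m, hm, hmW⟩ := exists_ne_zero_le_ker (W := lr ⊔ ls) (by omega)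
    refine hT.not_residualDisc_subset_lines hs hl ha hb hab hspan hm
      (fun x hx => hmW x (Submodule.mem_sup_left hx)) fun y₀ _ => ?_
    obtain ⟨s, t, hst, h0⟩ := exists_isotropic (T a a y₀) (T a b y₀) (T b b y₀)
    rw [← hT.apply_comb_self] at h0
    have hx : s • a + t • b ∈ lr := add_mem (lr.smul_mem _ ha) (lr.smul_mem _ hb)
    have hne : s • a + t • b ≠ 0 := fun h' => by
      have := LinearIndependent.pair_iff.1 hab s t h'
      tauto
    refine ⟨T (s • a + t • b) (s • a + t • b), fun h => ?_, h0, fun a ha b hb hab y hd => ?_⟩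
    · obtain ⟨w, hw⟩ := hs _ hne
      exact hw (by rw [h, LinearMap.zero_apply])
    · by_contra! hcon
      obtain h | ⟨u, hu, hus, hu0, -⟩ := meet a ha b hb hab y ⟨_, hx, hcon.2⟩ hd
      · exact hcon.1 (hmW y h)
      · exact hu0 ((Submodule.mem_bot ℂ).1 (hinf ▸ Submodule.mem_inf.2 ⟨hu, hus⟩))
  · obtain ⟨p, hp, hp0⟩ := Submodule.exists_mem_ne_zero_of_ne_bot hinf
    have hpr := (Submodule.mem_inf.1 hp).1
    have hinf_pos : finrank ℂ ↥(lr ⊓ ls) ≠ 0 := fun h => hinf (Submodule.finrank_eq_zero.1 h)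
    have hinf_one : finrank ℂ ↥(lr ⊓ ls) = 1 := by
      have hle := Submodule.finrank_mono (inf_le_left : lr ⊓ ls ≤ lr)
      have : finrank ℂ ↥(lr ⊓ ls) ≠ 2 := fun h => hne <| by
        rw [← Submodule.eq_of_le_of_finrank_eq (inf_le_left : lr ⊓ ls ≤ lr) (h.trans hlr.symm),
          Submodule.eq_of_le_of_finrank_eq (inf_le_right : lr ⊓ ls ≤ ls) (h.trans hls.symm)]
      omega
    have hm : T p p ≠ 0 := fun h => by
      obtain ⟨w, hw⟩ := hs p hp0
      exact hw (by rw [h, LinearMap.zero_apply])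
    refine hT.not_residualDisc_subset_lines hs hl ha hb hab hspan hm
      (fun x hx => hT.apply_self_left_eq_zero hl hpr hx) fun y₀ _ => ?_
    obtain ⟨n, hn, hnW⟩ := exists_ne_zero_le_ker (W := (lr ⊔ ls) ⊔ Submodule.span ℂ {y₀}) (by
      have h1 := Submodule.finrank_add_le_finrank_add_finrank (lr ⊔ ls) (Submodule.span ℂ {y₀})
      have h2 : finrank ℂ (Submodule.span ℂ {y₀}) ≤ 1 := by
        simpa using finrank_span_le_card (R := ℂ) ({y₀} : Set V)
      omega)
    refine ⟨n, hn, hnW _ (Submodule.mem_sup_right (Submodule.mem_span_singleton_self y₀)),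
      fun a ha b hb hab y hd => ?_⟩
    by_contra! hcon
    obtain h | ⟨u, hu, hus, hu0, huy⟩ := meet a ha b hb hab y ⟨p, hpr, hcon.1⟩ hd
    · exact hcon.2 (hnW y (Submodule.mem_sup_left h))
    · obtain ⟨c, hc⟩ := (finrank_eq_one_iff_of_nonzero' (⟨u, hu, hus⟩ : ↥(lr ⊓ ls))
        (fun h => hu0 (congrArg Subtype.val h))).1 hinf_one ⟨p, hp⟩
      have hc : c • u = p := congrArg Subtype.val hc
      exact hcon.1 (by simp [← hc, huy])

/-- Let `l_r` be a line on the smooth cubic threefold `V` and `l_s` any line in `ℙ⁴`.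
Every line `l_t ⊆ V` with `l_t ≠ l_r` meeting `l_r` also meets `l_s` if and only if
`l_s = l_r`. -/
theorem statement9 (E : MvPolynomial (Fin 5) ℂ) (hE : IsSmoothCubic E)
    (lr ls : Submodule ℂ (Fin 5 → ℂ))
    (hlr : finrank ℂ lr = 2) (hlrV : SubsetV E lr) (hls : finrank ℂ ls = 2) :
    (∀ lt : Submodule ℂ (Fin 5 → ℂ), finrank ℂ lt = 2 → SubsetV E lt →
      lt ≠ lr → lt ⊓ lr ≠ ⊥ → lt ⊓ ls ≠ ⊥) ↔ ls = lr := by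
  refine ⟨fun H => ?_, fun h lt _ _ _ hlt => h ▸ hlt⟩
  obtain ⟨T, hT, hET, hs⟩ := exists_symmTrilinear hE
  have hl : ∀ x ∈ lr, T x x x = 0 := fun x hx => by rw [← hET, hlrV x hx]
  refine hT.eq_of_forall_meet (by simp) hs hlr hls hl fun u hu hu0 v hv h1 h2 h3 => ?_
  have huv : LinearIndependent ℂ ![u, v] := by
    rw [LinearIndependent.pair_iff' hu0]
    rintro c rfl
    exact hv (lr.smul_mem c hu)
  have hfin : finrank ℂ (Submodule.span ℂ {u, v}) = 2 := by
    have := finrank_span_eq_card huv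
    rwa [Matrix.range_cons, Matrix.range_cons, Matrix.range_empty, Set.union_empty,
      ← Set.insert_eq, Fintype.card_fin] at this
  have hu_mem : u ∈ Submodule.span ℂ {u, v} := Submodule.subset_span (by simp)
  have hv_mem : v ∈ Submodule.span ℂ {u, v} := Submodule.subset_span (by simp)
  have hsub : SubsetV E (Submodule.span ℂ {u, v}) := by
    intro x hx
    obtain ⟨p, q, rfl⟩ := Submodule.mem_span_pair.1 hx
    have e1 : T u v u = 0 := by rw [hT.right, h1]
    have e2 : T v v u = 0 := by rw [hT.right, hT.left, h2]
    rw [hET, hT.apply_comb_self]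
    simp [hl u hu, h1, h2, h3, e1, e2]
  obtain ⟨x, hx, hx0⟩ := Submodule.exists_mem_ne_zero_of_ne_bot <|
    H _ hfin hsub (fun h => hv (h ▸ hv_mem)) fun h =>
      hu0 ((Submodule.mem_bot ℂ).1 (h ▸ Submodule.mem_inf.2 ⟨hu_mem, hu⟩))
  obtain ⟨hxt, hxs⟩ := Submodule.mem_inf.1 hx
  obtain ⟨p, q, rfl⟩ := Submodule.mem_span_pair.1 hxt
  exact ⟨p, q, hxs, hx0⟩
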